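/- arXiv:1610.09162 — 2 statements merged into one kernel-verified Lean document; each statement's English description precedes it below -/
import Mathlib

section
/- If k is an analytic field with a nontrivial absolute value which possesses a countable dense subfield (i.e. k is the completion of a countable field), then the extension hat{k^a}/k is primitive: there exists t ∈ hat{k^a} with hat{k^a} = hat{k(t)}. In particular, the completed algebraic closure of ℚ_p is topologically generated over ℚ_p by a single element. -/
open Metric

set_option linter.unusedSectionVars false

/-!
Ambient setting: every extension of analytic (complete, non-archimedean, real-valued)
fields `L/K` embeds isometrically into an algebraically closed, complete,
non-archimedean normed field `Ω` (e.g. the completed algebraic closure of `L`).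
We therefore formalize analytic fields as closed subfields of such an ambient field `Ω`.
-/

variable {Ω : Type*} [NormedField Ω] [CompleteSpace Ω] [IsUltrametricDist Ω] [IsAlgClosed Ω]

/-- The completion `hat{K(S)}` of the subfield generated by `K` and `S`, realized inside
the ambient analytic field `Ω` as the topological closure of the generated subfield. -/
noncomputable def hatGen (K : Subfield Ω) (S : Set Ω) : Subfield Ω :=
  (Subfield.closure ((K : Set Ω) ∪ S)).topologicalClosure

/-- `t` is topologically algebraic ("topgebraic") over `K`: it lies in the closure of the
set of elements algebraic over `K`, i.e. in the completed algebraic closure `hat{K^a}`. -/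
def IsTopgebraicElem (K : Subfield Ω) (t : Ω) : Prop :=
  t ∈ closure {x : Ω | IsAlgebraic K x}

/-- `t` is topologically transcendental over `K`. -/
def TopTranscendental (K : Subfield Ω) (t : Ω) : Prop := ¬ IsTopgebraicElem K t

/-- `S` is topgebraically independent over `K`: every `x ∈ S` is topologically
transcendental over `hat{K(S \ {x})}`. -/
def TopgebraicIndep (K : Subfield Ω) (S : Set Ω) : Prop :=
  ∀ x ∈ S, TopTranscendental (hatGen K (S \ {x})) x

/-- `S` topgebraically generates `L` over `K`: the extension `L / hat{K(S)}` is
topgebraic, i.e. `L` is contained in the completed algebraic closure of `hat{K(S)}`. -/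
def TopgebraicallyGenerates (K L : Subfield Ω) (S : Set Ω) : Prop :=
  (L : Set Ω) ⊆ closure {x : Ω | IsAlgebraic (hatGen K S) x}

/-- The topological transcendence degree of `L/K`: the least cardinal bounding the
cardinality of every topgebraically independent subset of `L`. -/
noncomputable def topdeg (K L : Subfield Ω) : Cardinal :=
  ⨆ S : {S : Set Ω // S ⊆ (L : Set Ω) ∧ TopgebraicIndep K S}, Cardinal.mk S.1

/-- The topgebraic generating degree of `L/K`: the least cardinality of a
topgebraically generating subset of `L` over `K`. -/
noncomputable def Topdeg (K L : Subfield Ω) : Cardinal :=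
  ⨅ S : {S : Set Ω // S ⊆ (L : Set Ω) ∧ TopgebraicallyGenerates K L S}, Cardinal.mk S.1

/-- The `K`-radius of `t`: the distance from `t` to the algebraic closure of `K`. -/
noncomputable def rad (K : Subfield Ω) (t : Ω) : ℝ :=
  Metric.infDist t {x : Ω | IsAlgebraic K x}

/-- The `K`-multiradius of an element `t` of `S`. -/
noncomputable def radS (K : Subfield Ω) (S : Set Ω) (t : Ω) : ℝ :=
  rad (hatGen K (S \ {t})) t

lemma mem_hatGen_of_mem {K : Subfield Ω} {S : Set Ω} {c : Ω} (hc : c ∈ K) : c ∈ hatGen K S :=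
  Subfield.le_topologicalClosure _ (Subfield.subset_closure (Or.inl hc))

lemma mem_hatGen_of_mem_set {K : Subfield Ω} {S : Set Ω} {t : Ω} (ht : t ∈ S) : t ∈ hatGen K S :=
  Subfield.le_topologicalClosure _ (Subfield.subset_closure (Or.inr ht))

open Polynomial in
/-- A root of `p : F[X]` is isolated among the roots of `p`. -/
lemma exists_pos_le_norm_sub_of_aeval_eq_zero (F : Subfield Ω) {p : F[X]} (hp : p ≠ 0) (b : Ω) :
    ∃ r : ℝ, 0 < r ∧ ∀ x : Ω, aeval x p = 0 → b ≠ x → r ≤ ‖b - x‖ := by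
  have hfin : ((p.rootSet Ω) \ {b}).Finite := (p.rootSet_finite Ω).subset Set.sdiff_subset
  obtain ⟨r, hr, hball⟩ := Metric.nhds_basis_ball.mem_iff.1
    (hfin.isClosed.isOpen_compl.mem_nhds (by simp : b ∈ ((p.rootSet Ω) \ {b})ᶜ))
  refine ⟨r, hr, fun x hx hbx => ?_⟩
  by_contra! h
  have hmem : x ∈ ball b r := by rwa [mem_ball, dist_comm, dist_eq_norm]
  exact hball hmem ⟨(mem_rootSet_of_ne hp).2 hx, fun h' => hbx h'.symm⟩

/-- Krasner's lemma, with a radius uniform over all complete intermediate fields. -/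
lemma exists_krasner_radius (F : Subfield Ω) {b : Ω} (hb : IsSeparable F b) :
    ∃ r : ℝ, 0 < r ∧ ∀ K : Subfield Ω, F ≤ K → IsClosed (K : Set Ω) →
      (∃ x : K, x ≠ 0 ∧ ‖x‖ ≠ 1) → ∀ y ∈ K, ‖b - y‖ < r → b ∈ K := by
  obtain ⟨r, hr, hroots⟩ :=
    exists_pos_le_norm_sub_of_aeval_eq_zero F (minpoly.ne_zero hb.isIntegral) b
  refine ⟨r, hr, fun K hFK hK hnt y hy hyb => ?_⟩
  let : NontriviallyNormedField K := NontriviallyNormedField.ofNormNeOne hnt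
  have : CompleteSpace K := hK.completeSpace_coe
  have : IsUltrametricDist K := ⟨fun a b c => IsUltrametricDist.dist_triangle_max (a : Ω) b c⟩
  let : Algebra F K := (Subfield.inclusion hFK).toAlgebra
  have : IsScalarTower F K Ω := IsScalarTower.of_algebraMap_eq fun _ => rfl
  have hbK : IsSeparable K b := IsSeparable.tower_top K hb
  let L := algebraicClosure K Ω
  let : NormedAlgebra K L := ⟨fun a x => norm_mul_le (a : Ω) x⟩
  let b' : L := ⟨b, mem_algebraicClosure_iff.2 hbK.isIntegral.isAlgebraic⟩
  let y' : L := algebraMap K L ⟨y, hy⟩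
  have hb' : IsSeparable K b' :=
    (isSeparable_map_iff L.val L.val.injective).1 hbK
  have hmem : b' ∈ IntermediateField.adjoin K {y'} := by
    refine IsKrasner.krasner hb' ?_ isIntegral_algebraMap fun x hx hbx => ?_
    · have : IsAlgClosed L := IsAlgClosure.isAlgClosed K
      exact IsAlgClosed.splits _
    · refine hyb.trans_le (hroots x ?_ fun h => hbx (Subtype.ext h))
      refine minpoly.aeval_of_isScalarTower F b (x : Ω) (K := K) ?_
      have h := congrArg L.val hx.aeval_eq_zero
      rwa [← Polynomial.aeval_algHom_apply, ← minpoly.algHom_eq L.val L.val.injective,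
        map_zero] at h
  rw [IntermediateField.adjoin_simple_eq_bot_iff.2 (IntermediateField.algebraMap_mem _ _),
    IntermediateField.mem_bot] at hmem
  obtain ⟨z, hz⟩ := hmem
  have : (z : Ω) = b := congrArg Subtype.val hz
  exact this ▸ z.2

open Polynomial in
/-- Adding a linear term `d X` to `f` makes it separable for all but finitely many `d`. -/
lemma finite_setOf_not_separable_add_C_mul_X {F : Type*} [Field F] {f : F[X]}
    (hf : f.coeff 0 ≠ 0) : {d : F | ¬ (f + C d * X).Separable}.Finite := by
  let E := AlgebraicClosure F
  let h : F[X] := f - X * derivative f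
  have hh : h ≠ 0 := fun h0 => hf <| by
    simpa [h] using congrArg (fun p => coeff p 0) h0
  have hfin : ((fun y : E => -aeval y (derivative f)) '' h.rootSet E).Finite :=
    (h.rootSet_finite E).image _
  refine Set.Finite.subset (hfin.preimage (algebraMap F E).injective.injOn) fun d hd => ?_
  have hd' : ¬ IsCoprime (f + C d * X) (derivative (f + C d * X)) := hd
  rw [isCoprime_iff_aeval_ne_zero_of_isAlgClosed F E] at hd'
  push Not at hd'
  obtain ⟨y, h1, h2⟩ := hd'
  simp only [map_add, map_mul, aeval_C, aeval_X, derivative_mul, derivative_C,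
    derivative_X, zero_mul, zero_add, mul_one] at h1 h2
  refine ⟨y, (mem_rootSet_of_ne hh).2 ?_, ?_⟩
  · simp only [h, map_sub, map_mul, aeval_X]
    linear_combination h1 - y * h2
  · linear_combination -h2

/-- A real bound tending to zero that controls root perturbation. -/
lemma exists_pos_rpow_mul_lt (n : ℕ) (hn : n ≠ 0) (M : ℝ) {ε : ℝ} (hε : 0 < ε) :
    ∃ δ : ℝ, 0 < δ ∧ (((n : ℝ) + 1) * δ) ^ (n : ℝ)⁻¹ * M < ε := by
  have hlim : Filter.Tendsto (fun δ : ℝ => (((n : ℝ) + 1) * δ) ^ (n : ℝ)⁻¹ * M)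
      (nhdsWithin 0 (Set.Ioi 0)) (nhds 0) := by
    have hc : Continuous fun δ : ℝ => (((n : ℝ) + 1) * δ) ^ (n : ℝ)⁻¹ * M :=
      ((continuous_const.mul continuous_id).rpow_const fun _ => Or.inr (by positivity)).mul
        continuous_const
    have := hc.tendsto 0
    rw [mul_zero, Real.zero_rpow (by simpa using hn), zero_mul] at this
    exact this.mono_left nhdsWithin_le_nhds
  obtain ⟨δ, h1, h2⟩ := ((hlim.eventually (gt_mem_nhds hε)).and self_mem_nhdsWithin).exists
  exact ⟨δ, h2, h1⟩

open Polynomial in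
/-- Elements algebraic over a normed field are limits of elements algebraic over a dense subfield. -/
lemma exists_isAlgebraic_norm_sub_lt {F K L : Type*} [Field F] [NormedField K] [NormedField L]
    [IsAlgClosed L] [Algebra F K] [NormedAlgebra K L] [Algebra F L] [IsScalarTower F K L]
    (hdense : DenseRange (algebraMap F K)) {x : L} (hx : IsAlgebraic K x) {ε : ℝ} (hε : 0 < ε) :
    ∃ y : L, IsAlgebraic F y ∧ ‖x - y‖ < ε := by
  have hn := (minpoly.natDegree_pos hx.isIntegral).ne'
  obtain ⟨δ, hδ, hδε⟩ := exists_pos_rpow_mul_lt _ hn (max ‖x‖ 1) hε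
  obtain ⟨g, hg, hdeg, hcoeff⟩ :=
    exists_monic_and_natDegree_eq_and_norm_map_algebraMap_coeff_sub_lt hdense
      (minpoly.monic hx.isIntegral) hδ
  obtain ⟨y, hy, hxy⟩ := exists_aroots_norm_sub_lt_of_norm_coeff_sub_lt hδ
    (minpoly.aeval K x) (minpoly.monic hx.isIntegral) (hg.map _) (by simp [hdeg]) hcoeff
    (IsAlgClosed.splits _)
  refine ⟨y, ⟨g, hg.ne_zero, ?_⟩, hxy.trans hδε⟩
  simpa using (mem_aroots'.1 hy).2

open Polynomial in
/-- Over a nontrivially normed field, separable elements are dense among algebraic ones. -/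
lemma exists_isSeparable_norm_sub_lt {F L : Type*} [NontriviallyNormedField F] [NormedField L]
    [IsAlgClosed L] [NormedAlgebra F L] {x : L} (hx : IsAlgebraic F x) {ε : ℝ} (hε : 0 < ε) :
    ∃ y : L, IsSeparable F y ∧ ‖x - y‖ < ε := by
  by_cases hsep : IsSeparable F x
  · exact ⟨x, hsep, by simpa⟩
  set f := minpoly F x with hf
  have hfm : f.Monic := minpoly.monic hx.isIntegral
  have hn : f.natDegree ≠ 0 := (minpoly.natDegree_pos hx.isIntegral).ne'
  have hn1 : f.natDegree ≠ 1 := fun h => hsep <| by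
    obtain ⟨z, rfl⟩ := minpoly.natDegree_eq_one_iff.1 h
    exact isSeparable_algebraMap z
  have hf0 : f.coeff 0 ≠ 0 := minpoly.coeff_zero_ne_zero hx.isIntegral fun h => hsep <| by
    rw [h, ← map_zero (algebraMap F L)]
    exact isSeparable_algebraMap 0
  obtain ⟨δ, hδ, hδε⟩ := exists_pos_rpow_mul_lt _ hn (max ‖x‖ 1) hε
  obtain ⟨d, hd, hdsep⟩ : ∃ d : F, ‖d‖ < δ ∧ (f + C d * X).Separable := by
    have hinf : (ball (0 : F) δ).Infinite := infinite_of_mem_nhds 0 (ball_mem_nhds 0 hδ)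
    obtain ⟨d, hd, hd'⟩ := (hinf.sdiff (finite_setOf_not_separable_add_C_mul_X hf0)).nonempty
    exact ⟨d, by simpa using hd, by simpa using hd'⟩
  have hdeg : (C d * X : F[X]).degree < f.degree := by
    refine (degree_C_mul_X_le d).trans_lt ?_
    rw [degree_eq_natDegree hfm.ne_zero]
    exact_mod_cast (by omega : 1 < f.natDegree)
  obtain ⟨y, hy, hxy⟩ := exists_aroots_norm_sub_lt_of_norm_coeff_sub_lt (g := f + C d * X) hδ
    (minpoly.aeval F x) hfm (hfm.add_of_left hdeg)
    (natDegree_eq_of_degree_eq (degree_add_eq_left_of_degree_lt hdeg)) (fun i => by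
      rw [coeff_add, ← hf, add_sub_cancel_left, coeff_C_mul, coeff_X]
      split_ifs <;> simp [hd, hδ])
    (IsAlgClosed.splits _)
  refine ⟨y, hdsep.of_dvd (minpoly.dvd F y ?_), hxy.trans hδε⟩
  simpa using (mem_aroots'.1 hy).2

lemma exists_ne_zero_norm_ne_one_of_dense {D k : Subfield Ω}
    (hD : (k : Set Ω) ⊆ closure (D : Set Ω)) (hk : ∃ x : Ω, x ∈ k ∧ x ≠ 0 ∧ ‖x‖ ≠ 1) :
    ∃ x : D, x ≠ 0 ∧ ‖x‖ ≠ 1 := by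
  obtain ⟨x, hxk, hx0, hx1⟩ := hk
  have hopen : IsOpen {y : Ω | y ≠ 0 ∧ ‖y‖ ≠ 1} :=
    isOpen_ne.inter (isOpen_ne.preimage continuous_norm)
  obtain ⟨d, ⟨hd0, hd1⟩, hd⟩ := mem_closure_iff.1 (hD hxk) _ hopen ⟨hx0, hx1⟩
  exact ⟨⟨d, hd⟩, fun h => hd0 (congrArg Subtype.val h), hd1⟩

/-- A convergent series `∑ cₙ aₙ` whose `n`-th partial sum `bₙ` approximates the limit to within
a prescribed radius depending on `bₙ`. -/
lemma exists_limit_norm_sub_lt {D : Subfield Ω} (hD : ∃ x : D, x ≠ 0 ∧ ‖x‖ ≠ 1)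
    (a : ℕ → Ω) (r : Ω → ℝ) (hr : ∀ x, 0 < r x) :
    ∃ (b : ℕ → Ω) (c : ℕ → D) (t : Ω), b 0 = 0 ∧ (∀ n, c n ≠ 0) ∧
      (∀ n, b (n + 1) = b n + c n * a n) ∧ Filter.Tendsto b Filter.atTop (nhds t) ∧
      ∀ n, ‖b n - t‖ < r (b n) := by
  let : NontriviallyNormedField D := NontriviallyNormedField.ofNormNeOne hD
  have hc : ∀ (x : Ω) (ρ : ℝ), ∃ c : D, c ≠ 0 ∧ (0 < ρ → ‖(c : Ω) * x‖ < ρ) := fun x ρ => by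
    by_cases hρ : 0 < ρ
    · obtain ⟨c, hc0, hc⟩ := NormedField.exists_norm_lt D (by positivity : 0 < ρ / (‖x‖ + 1))
      refine ⟨c, norm_pos_iff.1 hc0, fun _ => ?_⟩
      rw [lt_div_iff₀ (by positivity)] at hc
      rw [norm_mul]
      exact (mul_le_mul_of_nonneg_left (by linarith) (norm_nonneg _)).trans_lt hc
    · exact ⟨1, one_ne_zero, fun h => absurd h hρ⟩
  choose γ hγ0 hγ using hc
  let s : ℕ → Ω × ℝ := fun n => n.rec (0, r 0 / 2) fun n p =>
    let b := p.1 + γ (a n) p.2 * a n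
    (b, min (p.2 / 2) (r b / 2))
  have hs : ∀ n, s (n + 1) = ((s n).1 + γ (a n) (s n).2 * a n, min ((s n).2 / 2)
      (r ((s n).1 + γ (a n) (s n).2 * a n) / 2)) := fun n => rfl
  have hpos : ∀ n, 0 < (s n).2 := fun n => by
    induction n with
    | zero => exact half_pos (hr 0)
    | succ n ih => rw [hs]; exact lt_min (half_pos ih) (half_pos (hr _))
  have hrad : ∀ n, (s n).2 ≤ r (s n).1 / 2 := fun n => by
    cases n with
    | zero => exact le_rfl
    | succ n => rw [hs]; exact min_le_right _ _
  have hhalf : ∀ n, (s (n + 1)).2 ≤ (s n).2 / 2 := fun n => by rw [hs]; exact min_le_left _ _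
  have hanti : Antitone fun n => (s n).2 :=
    antitone_nat_of_succ_le fun n => (hhalf n).trans (half_le_self (hpos n).le)
  have hgeom : ∀ n, (s n).2 ≤ r 0 / 2 * (1 / 2) ^ n := fun n => by
    induction n with
    | zero => simp [s]
    | succ n ih => rw [pow_succ]; linarith [hhalf n]
  have hstep : ∀ n, ‖(s (n + 1)).1 - (s n).1‖ < (s n).2 := fun n => by
    rw [hs, add_sub_cancel_left]; exact hγ _ _ (hpos n)
  obtain ⟨t, ht⟩ := cauchySeq_tendsto_of_complete
    (cauchySeq_of_le_geometric (f := fun n => (s n).1) (1 / 2) (r 0 / 2) (by norm_num) fun n => by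
      rw [dist_comm, dist_eq_norm]; exact (hstep n).le.trans (hgeom n))
  have hdist : ∀ n m, ‖(s n).1 - (s (n + m)).1‖ ≤ (s n).2 := fun n m => by
    induction m with
    | zero => simpa using (hpos n).le
    | succ m ih =>
      rw [← sub_add_sub_cancel _ (s (n + m)).1]
      refine (IsUltrametricDist.norm_add_le_max _ _).trans (max_le ih ?_)
      rw [norm_sub_rev]
      exact (hstep (n + m)).le.trans (hanti (Nat.le_add_right n m))
  refine ⟨fun n => (s n).1, fun n => γ (a n) (s n).2, t, rfl, fun n => hγ0 _ _, fun n => rfl, ht,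
    fun n => ?_⟩
  have hlim : ‖(s n).1 - t‖ ≤ (s n).2 :=
    le_of_tendsto (tendsto_const_nhds.sub ht).norm <| by
      filter_upwards [Filter.eventually_ge_atTop n] with m hm
      obtain ⟨j, rfl⟩ := Nat.exists_eq_add_of_le hm
      exact hdist n j
  exact hlim.trans_lt ((hrad n).trans_lt (half_lt_self (hr _)))

/-- Corollary 5.1.3: if `k` is a nontrivially valued analytic field
possessing a countable dense subfield (i.e. `k` is the completion of a countable field),
then `hat{k^a}/k` is primitive: the completed algebraic closure of `k` is topologically
generated over `k` by a single element. (In particular this applies to `ℂ_p/ℚ_p`.) -/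
theorem completed_algebraic_closure_primitive (k : Subfield Ω)
    (hkc : IsClosed (k : Set Ω))
    (hnontriv : ∃ x : Ω, x ∈ k ∧ x ≠ 0 ∧ ‖x‖ ≠ 1)
    (D : Subfield Ω) (hDk : D ≤ k) (hDcount : Countable D)
    (hDdense : (k : Set Ω) ⊆ closure (D : Set Ω)) :
    ∃ t : Ω, (hatGen k ({t} : Set Ω) : Set Ω) = closure {x : Ω | IsAlgebraic k x} := by
  have hD := exists_ne_zero_norm_ne_one_of_dense hDdense hnontriv
  have hcount := (Algebraic.countable (R := D) (A := Ω)).mono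
    fun (x : Ω) (hx : IsSeparable D x) => hx.isIntegral.isAlgebraic
  obtain ⟨a, ha⟩ := Set.Countable.exists_eq_range hcount
    ⟨algebraMap D Ω 0, isSeparable_algebraMap 0⟩
  have hasep : ∀ n, IsSeparable D (a n) := fun n => by
    have : a n ∈ Set.range a := ⟨n, rfl⟩
    rwa [← ha] at this
  have hrad : ∀ b : Ω, ∃ r : ℝ, 0 < r ∧ (IsSeparable D b → ∀ K : Subfield Ω, D ≤ K →
      IsClosed (K : Set Ω) → (∃ x : K, x ≠ 0 ∧ ‖x‖ ≠ 1) → ∀ y ∈ K, ‖b - y‖ < r → b ∈ K) :=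
    fun b => by
      by_cases hb : IsSeparable D b
      · obtain ⟨r, hr, h⟩ := exists_krasner_radius D hb
        exact ⟨r, hr, fun _ => h⟩
      · exact ⟨1, one_pos, fun h => absurd h hb⟩
  choose r hr hkrasner using hrad
  obtain ⟨b, c, t, hb0, hc, hb, hbt, hlt⟩ := exists_limit_norm_sub_lt hD a r hr
  have hbsep : ∀ n, IsSeparable D (b n) := fun n => by
    induction n with
    | zero => rw [hb0, ← map_zero (algebraMap D Ω)]; exact isSeparable_algebraMap 0
    | succ n ih =>
      rw [hb]
      exact Field.isSeparable_add ih
        (Field.isSeparable_mul (isSeparable_algebraMap (c n)) (hasep n))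
  have halg : ∀ {x : Ω}, IsSeparable D x → IsAlgebraic k x := fun hx => by
    let : Algebra D k := (Subfield.inclusion hDk).toAlgebra
    have : IsScalarTower D k Ω := IsScalarTower.of_algebraMap_eq fun _ => rfl
    exact hx.isIntegral.isAlgebraic.tower_top k
  have hcoe : (((algebraicClosure k Ω).toSubfield.topologicalClosure : Subfield Ω) : Set Ω) =
      closure {x : Ω | IsAlgebraic k x} := by
    refine congrArg closure (Set.ext fun x => ?_)
    exact mem_algebraicClosure_iff
  refine ⟨t, Set.Subset.antisymm ?_ ?_⟩
  · rw [← hcoe]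
    refine Subfield.topologicalClosure_minimal _ (Subfield.closure_le.2 ?_)
      (Subfield.isClosed_topologicalClosure _)
    rw [hcoe]
    rintro x (hx | rfl)
    · exact subset_closure (isAlgebraic_algebraMap (⟨x, hx⟩ : k))
    · exact mem_closure_of_tendsto hbt (Filter.Eventually.of_forall fun n => halg (hbsep n))
  · have hclosed : IsClosed (hatGen k {t} : Set Ω) := Subfield.isClosed_topologicalClosure _
    have hDK : D ≤ hatGen k {t} := fun x hx => mem_hatGen_of_mem (hDk hx)
    have hnt : ∃ x : hatGen k {t}, x ≠ 0 ∧ ‖x‖ ≠ 1 := by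
      obtain ⟨x, hx, hx0, hx1⟩ := hnontriv
      exact ⟨⟨x, mem_hatGen_of_mem hx⟩, fun h => hx0 (congrArg Subtype.val h), hx1⟩
    have hbK : ∀ n, b n ∈ hatGen k {t} := fun n =>
      hkrasner _ (hbsep n) _ hDK hclosed hnt t (mem_hatGen_of_mem_set rfl) (hlt n)
    have haK : ∀ n, a n ∈ hatGen k {t} := fun n => by
      have hcn : (c n : Ω) ≠ 0 := fun h => hc n (Subtype.ext h)
      have : a n = (c n : Ω)⁻¹ * (b (n + 1) - b n) := by
        rw [hb, add_sub_cancel_left, inv_mul_cancel_left₀ hcn]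
      rw [this]
      exact mul_mem (inv_mem (hDK (c n).2)) (sub_mem (hbK _) (hbK _))
    refine closure_minimal (fun x hx => ?_) hclosed
    rw [← hclosed.closure_eq]
    refine Metric.mem_closure_iff.2 fun ε hε => ?_
    let : Algebra D k := (Subfield.inclusion hDk).toAlgebra
    have : IsScalarTower D k Ω := IsScalarTower.of_algebraMap_eq fun _ => rfl
    have hdense : DenseRange (algebraMap D k) := Metric.denseRange_iff.2 fun z δ hδ => by
      obtain ⟨d, hd, hzd⟩ := Metric.mem_closure_iff.1 (hDdense z.2) δ hδ
      exact ⟨⟨d, hd⟩, hzd⟩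
    let : NormedAlgebra k Ω := ⟨fun a x => norm_mul_le (a : Ω) x⟩
    obtain ⟨y, hy, hxy⟩ := exists_isAlgebraic_norm_sub_lt hdense hx (half_pos hε)
    let : NontriviallyNormedField D := NontriviallyNormedField.ofNormNeOne hD
    let : NormedAlgebra D Ω := ⟨fun a x => norm_mul_le (a : Ω) x⟩
    obtain ⟨z, hz, hyz⟩ := exists_isSeparable_norm_sub_lt hy (half_pos hε)
    obtain ⟨n, rfl⟩ : z ∈ Set.range a := ha ▸ hz
    refine ⟨a n, haK n, ?_⟩
    rw [← dist_eq_norm] at hxy hyz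
    linarith [dist_triangle x y (a n)]
end

section
/- Assume that K/k is an extension of analytic fields such that hat{k^a} is not spherically complete, K is algebraically closed and spherically complete, and k has positive residue characteristic (char(tilde k) > 0). Then the extension K/k does not admit a topological transcendence basis. -/
open Metric

set_option linter.unusedSectionVars false

/-!
Ambient setting: every extension of analytic (complete, non-archimedean, real-valued)
fields `L/K` embeds isometrically into an algebraically closed, complete,
non-archimedean normed field `Ω` (e.g. the completed algebraic closure of `L`).
We therefore formalize analytic fields as closed subfields of such an ambient field `Ω`.
-/

variable {Ω : Type*} [NormedField Ω] [CompleteSpace Ω] [IsUltrametricDist Ω] [IsAlgClosed Ω]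

/-- A metric space is spherically complete if every nested (totally ordered by inclusion)
nonempty family of closed balls has nonempty intersection. -/
def SphericallyCompleteSpace (X : Type*) [MetricSpace X] : Prop :=
  ∀ B : Set (X × ℝ), B.Nonempty → (∀ p ∈ B, 0 ≤ p.2) →
    (∀ p ∈ B, ∀ q ∈ B, Metric.closedBall p.1 p.2 ⊆ Metric.closedBall q.1 q.2 ∨
      Metric.closedBall q.1 q.2 ⊆ Metric.closedBall p.1 p.2) →
    (⋂ p ∈ B, Metric.closedBall p.1 p.2).Nonempty

open Polynomial IntermediateField Module

section DistanceBounds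

variable {l : Subfield Ω}

lemma exists_mem_norm_between [IsAlgClosed l] {b : Ω} (hb : b ∈ l) (hb0 : 0 < ‖b‖)
    (hb1 : ‖b‖ < 1) {α β : ℝ} (hα : 0 < α) (hαβ : α < β) :
    ∃ a ∈ l, α < ‖a‖ ∧ ‖a‖ < β := by
  have hβ : 0 < β := hα.trans hαβ
  obtain ⟨n, hn⟩ := exists_pow_lt_of_lt_one hb0 ((div_lt_one hβ).2 hαβ)
  have hn0 : n ≠ 0 := by
    rintro rfl
    rw [pow_zero] at hn
    linarith
  obtain ⟨u, hu⟩ := IsAlgClosed.exists_pow_nat_eq (⟨b, hb⟩ : l) (Nat.pos_of_ne_zero hn0)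
  have hub : ‖(u : Ω)‖ ^ n = ‖b‖ := by
    rw [← norm_pow]
    exact congrArg (fun x : l => ‖(x : Ω)‖) hu
  have hu1 : α / β < ‖(u : Ω)‖ := by
    rw [← hub] at hn
    exact lt_of_pow_lt_pow_left₀ n (norm_nonneg _) hn
  have hu2 : ‖(u : Ω)‖ < 1 := by
    rw [← hub] at hb1
    exact (pow_lt_one_iff_of_nonneg (norm_nonneg _) hn0).1 hb1
  have hu0 : 0 < ‖(u : Ω)‖ := (div_pos hα hβ).trans hu1
  obtain ⟨m, hm1, hm2⟩ := exists_mem_Ioc_zpow hβ ((one_lt_inv₀ hu0).2 hu2)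
  refine ⟨((u : Ω)⁻¹) ^ m, zpow_mem (inv_mem u.2) m, ?_, ?_⟩
  · rw [norm_zpow, norm_inv]
    rw [zpow_add_one₀ (inv_ne_zero hu0.ne')] at hm2
    rw [div_lt_iff₀ hβ] at hu1
    calc α < ‖(u : Ω)‖ * β := hu1
      _ ≤ ‖(u : Ω)‖ * (‖(u : Ω)‖⁻¹ ^ m * ‖(u : Ω)‖⁻¹) := by gcongr
      _ = ‖(u : Ω)‖⁻¹ ^ m := by field_simp
  · rw [norm_zpow, norm_inv]
    exact hm1

/-- On polynomials over an algebraically closed field, differentiation at a point of distance at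
least `r` from the field has operator norm at most `1 / r`. -/
lemma norm_aeval_derivative_le [IsAlgClosed l] {s : Ω} {r : ℝ} (hr0 : 0 ≤ r)
    (hr : ∀ c ∈ l, r ≤ ‖s - c‖) (A : l[X]) :
    r * ‖aeval s (derivative A)‖ ≤ ‖aeval s A‖ := by
  have hA : A.Splits := IsAlgClosed.splits A
  induction hA using Submonoid.closure_induction with
  | mem f hf =>
    rcases hf with ⟨a, rfl⟩ | ⟨a, rfl⟩
    · simp
    · have := hr (-a : Ω) (neg_mem a.2)
      simpa [show algebraMap l Ω a = a from rfl] using this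
  | one => simp
  | mul f g _ _ hf hg =>
    rw [derivative_mul, map_add, map_mul, map_mul, map_mul, norm_mul]
    refine (mul_le_mul_of_nonneg_left (IsUltrametricDist.norm_add_le_max _ _) hr0).trans ?_
    rw [mul_max_of_nonneg _ _ hr0, norm_mul, norm_mul]
    refine max_le ?_ ?_
    · rw [← mul_assoc]
      gcongr
    · rw [mul_left_comm]
      gcongr

lemma exists_aeval_div_near {s g : Ω} (hg : g ∈ hatGen l {s}) {ε : ℝ} (hε : 0 < ε) :
    ∃ A B : l[X], aeval s B ≠ 0 ∧ ‖g - aeval s A / aeval s B‖ < ε := by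
  have hg' : g ∈ closure (Subfield.closure ((l : Set Ω) ∪ {s}) : Set Ω) := hg
  obtain ⟨h, hh, hgh⟩ := Metric.mem_closure_iff.1 hg' ε hε
  have hle : Subfield.closure ((l : Set Ω) ∪ {s}) ≤ (adjoin l {s}).toSubfield := by
    rw [Subfield.closure_le]
    rintro x (hx | rfl)
    · exact (adjoin l {s}).algebraMap_mem ⟨x, hx⟩
    · exact mem_adjoin_simple_self l x
  obtain ⟨A, B, rfl⟩ := (mem_adjoin_simple_iff l h).1 (hle hh)
  rw [dist_eq_norm] at hgh
  by_cases hB : aeval s B = 0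
  · refine ⟨0, 1, by simp, ?_⟩
    simpa [hB] using hgh
  · exact ⟨A, B, hB, hgh⟩

lemma norm_aeval_derivative_pow_le [IsAlgClosed l] {s : Ω} {r : ℝ} (hr0 : 0 ≤ r)
    (hr : ∀ c ∈ l, r ≤ ‖s - c‖) (A : l[X]) (e : ℕ) :
    r * ‖aeval s (derivative (A ^ e))‖ ≤ ‖(e : Ω)‖ * ‖aeval s A‖ ^ e := by
  rcases Nat.eq_zero_or_pos e with rfl | he
  · simp
  · have h := norm_aeval_derivative_le hr0 hr A
    rw [derivative_pow, map_mul, map_mul, norm_mul, norm_mul, map_pow, norm_pow, aeval_C,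
      map_natCast]
    calc r * (‖(e : Ω)‖ * ‖aeval s A‖ ^ (e - 1) * ‖aeval s (derivative A)‖)
        = ‖(e : Ω)‖ * ‖aeval s A‖ ^ (e - 1) * (r * ‖aeval s (derivative A)‖) := by ring
      _ ≤ ‖(e : Ω)‖ * ‖aeval s A‖ ^ (e - 1) * ‖aeval s A‖ := by gcongr
      _ = ‖(e : Ω)‖ * ‖aeval s A‖ ^ e := by rw [mul_assoc, pow_sub_one_mul he.ne']

lemma norm_sub_lt_of_lt {x y : Ω} {M : ℝ} (hx : ‖x‖ < M) (hy : ‖y‖ < M) : ‖x - y‖ < M := by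
  rw [sub_eq_add_neg]
  exact (IsUltrametricDist.norm_add_le_max _ _).trans_lt (max_lt hx (by rwa [norm_neg]))

lemma exists_aeval_div_near_of_continuous {s g : Ω} (hg : g ∈ hatGen l {s}) {f : Ω → Ω}
    (hf : Continuous f) {ε η : ℝ} (hε : 0 < ε) (hη : 0 < η) :
    ∃ A B : l[X], aeval s B ≠ 0 ∧ ‖aeval s A / aeval s B - g‖ < ε ∧
      ‖f (aeval s A / aeval s B) - f g‖ < η := by
  obtain ⟨δ, hδ, h⟩ := Metric.continuous_iff.1 hf g η hη
  obtain ⟨A, B, hB, hAB⟩ := exists_aeval_div_near hg (lt_min hε hδ)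
  rw [norm_sub_rev] at hAB
  refine ⟨A, B, hB, hAB.trans_le (min_le_left _ _), ?_⟩
  rw [← dist_eq_norm]
  exact h _ (by rw [dist_eq_norm]; exact hAB.trans_le (min_le_right _ _))

lemma norm_mul_le_of_pow_eq_sub_pow [IsAlgClosed l] {s : Ω} {r : ℝ} (hr0 : 0 < r)
    (hr : ∀ c ∈ l, r ≤ ‖s - c‖) {N c : Ω} (hN : N ∈ hatGen l {s}) (hc : c ∈ l) {e D : ℕ}
    (h : N ^ e = (s - c) ^ D) : ‖(D : Ω)‖ * r ≤ ‖(e : Ω)‖ * ‖s - c‖ := by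
  by_contra! hlt
  have ht : 0 < ‖s - c‖ := hr0.trans_le (hr c hc)
  have hD : 0 < ‖(D : Ω)‖ := by
    have := (mul_nonneg (norm_nonneg (e : Ω)) ht.le).trans_lt hlt
    exact pos_of_mul_pos_left this hr0.le
  have hD0 : D ≠ 0 := by
    rintro rfl
    simp at hD
  have hη : 0 < ‖s - c‖ ^ (D - 1) * (‖(D : Ω)‖ * r) := by positivity
  obtain ⟨A, B, hB, -, hAB⟩ :=
    exists_aeval_div_near_of_continuous hN (f := fun x => x ^ e) (by fun_prop) one_pos hη
  simp only [h] at hAB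
  have hb : 0 < ‖aeval s B‖ := norm_pos_iff.2 hB
  set M := ‖s - c‖ ^ (D - 1) * (‖(D : Ω)‖ * r) * ‖aeval s B‖ ^ e with hM
  have hQ : ‖aeval s A ^ e - (s - c) ^ D * aeval s B ^ e‖ < M := by
    have : aeval s A ^ e - (s - c) ^ D * aeval s B ^ e
        = ((aeval s A / aeval s B) ^ e - (s - c) ^ D) * aeval s B ^ e := by
      rw [div_pow, sub_mul, div_mul_cancel₀ _ (pow_ne_zero _ hB)]
    rw [this, norm_mul, norm_pow (aeval s B), hM]
    gcongr
  have hMt : M ≤ ‖s - c‖ ^ D * ‖aeval s B‖ ^ e := by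
    rw [hM, ← pow_sub_one_mul hD0 ‖s - c‖]
    gcongr
    calc ‖(D : Ω)‖ * r ≤ 1 * ‖s - c‖ := by
          gcongr
          · exact IsUltrametricDist.norm_natCast_le_one Ω D
          · exact hr c hc
      _ = ‖s - c‖ := one_mul _
  have hA : ‖aeval s A‖ ^ e ≤ ‖s - c‖ ^ D * ‖aeval s B‖ ^ e := by
    rw [← norm_pow, ← norm_pow, ← norm_pow, ← norm_mul]
    rw [← norm_pow, ← norm_pow, ← norm_mul] at hMt
    calc ‖aeval s A ^ e‖
        = ‖(aeval s A ^ e - (s - c) ^ D * aeval s B ^ e) + (s - c) ^ D * aeval s B ^ e‖ := by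
          rw [sub_add_cancel]
      _ ≤ _ := (IsUltrametricDist.norm_add_le_max _ _).trans (max_le (hQ.le.trans hMt) le_rfl)
  have hltM : ‖(e : Ω)‖ * (‖s - c‖ ^ D * ‖aeval s B‖ ^ e) < M := by
    rw [hM, ← pow_sub_one_mul hD0 ‖s - c‖]
    calc ‖(e : Ω)‖ * (‖s - c‖ ^ (D - 1) * ‖s - c‖ * ‖aeval s B‖ ^ e)
        = ‖s - c‖ ^ (D - 1) * (‖(e : Ω)‖ * ‖s - c‖) * ‖aeval s B‖ ^ e := by ring
      _ < _ := by gcongr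
  set c' : l := ⟨c, hc⟩
  have hcc : algebraMap l Ω c' = c := rfl
  have hQ' := norm_aeval_derivative_le hr0.le hr (A ^ e - (X - C c') ^ D * B ^ e)
  have hA' := norm_aeval_derivative_pow_le hr0.le hr A e
  have hB' := norm_aeval_derivative_pow_le hr0.le hr B e
  set QD := aeval s (derivative (A ^ e - (X - C c') ^ D * B ^ e)) with hQD
  have hident : (D : Ω) * (s - c) ^ (D - 1) * aeval s B ^ e
      = aeval s (derivative (A ^ e)) - (s - c) ^ D * aeval s (derivative (B ^ e)) - QD := by
    have : aeval s (derivative ((X - C c') ^ D)) = (D : Ω) * (s - c) ^ (D - 1) := by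
      simp [derivative_pow, hcc]
    rw [hQD, derivative_sub, derivative_mul, map_sub, map_add, map_mul, map_mul, this]
    simp only [map_pow, map_sub, aeval_X, aeval_C, hcc]
    ring
  have key : r * ‖(D : Ω) * (s - c) ^ (D - 1) * aeval s B ^ e‖ < r * (M / r) := by
    rw [hident]
    refine mul_lt_mul_of_pos_left ?_ hr0
    refine norm_sub_lt_of_lt (norm_sub_lt_of_lt ?_ ?_) ?_ <;> rw [lt_div_iff₀' hr0]
    · refine (hA'.trans ?_).trans_lt hltM
      gcongr
    · rw [norm_mul, norm_pow, mul_left_comm]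
      refine lt_of_le_of_lt ?_ hltM
      calc ‖s - c‖ ^ D * (r * ‖aeval s (derivative (B ^ e))‖)
          ≤ ‖s - c‖ ^ D * (‖(e : Ω)‖ * ‖aeval s B‖ ^ e) := by gcongr
        _ = _ := by ring
    · refine hQ'.trans_lt ?_
      simpa only [map_pow, map_sub, map_mul, aeval_X, aeval_C, hcc] using hQ
  rw [mul_div_cancel₀ _ hr0.ne', norm_mul, norm_mul, norm_pow, norm_pow, hM] at key
  exact key.ne (by ring)

lemma norm_mul_le_of_artinSchreier [IsAlgClosed l] {s : Ω} {r : ℝ} (hr0 : 0 < r)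
    (hr : ∀ c ∈ l, r ≤ ‖s - c‖) {p : ℕ} (hp0 : p ≠ 0) (hp : (p : Ω) = 0) {g a : Ω}
    (hg : g ∈ hatGen l {s}) (ha : a ∈ l) (h : g ^ p - g = a * s) : ‖a‖ * r ≤ ‖g‖ := by
  by_contra! hlt
  have hη : 0 < ‖a‖ * r := (norm_nonneg g).trans_lt hlt
  obtain ⟨A, B, hB, hAg, hAB⟩ :=
    exists_aeval_div_near_of_continuous hg (f := fun x => x ^ p - x) (by fun_prop) hη hη
  simp only [h] at hAB
  have hb : 0 < ‖aeval s B‖ := norm_pos_iff.2 hB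
  set M := ‖a‖ * r * ‖aeval s B‖ ^ p with hM
  have hBp : aeval s B ^ p = aeval s B * aeval s B ^ (p - 1) := (mul_pow_sub_one hp0 _).symm
  have hQ : ‖aeval s A ^ p - aeval s A * aeval s B ^ (p - 1) - a * s * aeval s B ^ p‖ < M := by
    have : aeval s A ^ p - aeval s A * aeval s B ^ (p - 1) - a * s * aeval s B ^ p
        = ((aeval s A / aeval s B) ^ p - aeval s A / aeval s B - a * s) * aeval s B ^ p := by
      obtain ⟨x, hx⟩ : ∃ x, x = aeval s A / aeval s B := ⟨_, rfl⟩
      have hxB : aeval s A = x * aeval s B := by rw [hx, div_mul_cancel₀ _ hB]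
      rw [← hx, hxB, mul_pow, hBp]
      ring
    rw [this, norm_mul, norm_pow (aeval s B), hM]
    gcongr
  have hA : ‖aeval s A‖ * ‖aeval s B‖ ^ (p - 1) < M := by
    have h1 : ‖aeval s A / aeval s B‖ < ‖a‖ * r := by
      rw [← sub_add_cancel (aeval s A / aeval s B) g]
      exact (IsUltrametricDist.norm_add_le_max _ _).trans_lt (max_lt hAg hlt)
    rw [norm_div, div_lt_iff₀ hb] at h1
    rw [hM, ← mul_pow_sub_one hp0 ‖aeval s B‖, ← mul_assoc]
    gcongr
  set a' : l := ⟨a, ha⟩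
  have haa : algebraMap l Ω a' = a := rfl
  have hQ' := norm_aeval_derivative_le hr0.le hr (A ^ p - A * B ^ (p - 1) - C a' * X * B ^ p)
  have hA' := norm_aeval_derivative_le hr0.le hr A
  have hB' := norm_aeval_derivative_pow_le hr0.le hr B (p - 1)
  set QD := aeval s (derivative (A ^ p - A * B ^ (p - 1) - C a' * X * B ^ p)) with hQD
  have hident : -(a * aeval s B ^ p)
      = QD - -(aeval s (derivative A) * aeval s B ^ (p - 1))
        - - (aeval s A * aeval s (derivative (B ^ (p - 1)))) := by
    have hpow (P : l[X]) : aeval s (derivative (P ^ p)) = 0 := by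
      rw [derivative_pow]
      simp [hp]
    have hX : derivative (C a' * X * B ^ p) = C a' * B ^ p + C a' * X * derivative (B ^ p) := by
      simp [derivative_mul]
    rw [hQD, derivative_sub, derivative_sub, hX, derivative_mul]
    simp only [map_sub, map_add, map_mul, map_pow, hpow, aeval_X, aeval_C, haa]
    ring
  have key : r * ‖-(a * aeval s B ^ p)‖ < r * (M / r) := by
    rw [hident]
    refine mul_lt_mul_of_pos_left ?_ hr0
    refine norm_sub_lt_of_lt (norm_sub_lt_of_lt ?_ ?_) ?_ <;> rw [lt_div_iff₀' hr0]
    · refine hQ'.trans_lt ?_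
      simpa only [map_pow, map_sub, map_mul, aeval_X, aeval_C, haa] using hQ
    · refine lt_of_le_of_lt ?_ hA
      rw [norm_neg, norm_mul, norm_pow, ← mul_assoc]
      gcongr
    · refine lt_of_le_of_lt ?_ hA
      rw [norm_neg, norm_mul, mul_left_comm]
      gcongr
      refine hB'.trans ?_
      exact mul_le_of_le_one_left (by positivity) (IsUltrametricDist.norm_natCast_le_one Ω _)
  rw [mul_div_cancel₀ _ hr0.ne', norm_neg, norm_mul, norm_pow, hM] at key
  exact key.ne (by ring)

end DistanceBounds

section Krasner

variable {F : Subfield Ω}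

lemma norm_eq_of_isConjRoot (hF : IsClosed (F : Set Ω)) {b : Ω} (hb : b ∈ F) (hb0 : 0 < ‖b‖)
    (hb1 : ‖b‖ < 1) {x x' : Ω} (hx : IsIntegral F x) (h : IsConjRoot F x x') : ‖x‖ = ‖x'‖ := by
  let _ : NontriviallyNormedField F := NontriviallyNormedField.ofNormNeOne
    ⟨⟨b, hb⟩, fun h0 => hb0.ne' (by simpa using congrArg (fun t : F => ‖(t : Ω)‖) h0), hb1.ne⟩
  let _ : NormedAlgebra F (algebraicClosure F Ω) :=
    { (inferInstance : Algebra F (algebraicClosure F Ω)) with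
      norm_smul_le := fun a t => by
        rw [Algebra.smul_def]
        exact (norm_mul (a : Ω) (t : Ω)).le }
  have : CompleteSpace F := hF.completeSpace_coe
  have key (t : algebraicClosure F Ω) : ‖(t : Ω)‖ = spectralValue (minpoly F (t : Ω)) := by
    exact (NormedAlgebra.norm_eq_spectralNorm F t).trans (congrArg spectralValue
      (minpoly.algebraMap_eq (B' := Ω) (algebraMap (algebraicClosure F Ω) Ω).injective t).symm)
  have e1 := key ⟨x, mem_algebraicClosure_iff.2 hx.isAlgebraic⟩
  have e2 := key ⟨x', mem_algebraicClosure_iff.2 (h.isIntegral hx).isAlgebraic⟩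
  rw [e1, e2]
  exact congrArg spectralValue h

lemma mem_intermediateField_of_norm_sub_lt (hF : IsClosed (F : Set Ω)) {b : Ω} (hb : b ∈ F)
    (hb0 : 0 < ‖b‖) (hb1 : ‖b‖ < 1) (M : IntermediateField F Ω) {P : F[X]} (hP : P.Separable)
    {y z : Ω} (hz : aeval z P = 0) {η : ℝ}
    (hη : ∀ z' : Ω, aeval z' P = 0 → z' ≠ z → η ≤ ‖z' - z‖)
    (hy : IsIntegral F y) (hyM : y ∈ M) (hyz : ‖z - y‖ < η) : z ∈ M := by
  have hzsep : IsSeparable F z := hP.of_dvd (minpoly.dvd F z hz)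
  have hzM : IsSeparable M z := hzsep.tower_top M
  by_contra hzn
  obtain ⟨z', hne, hconj⟩ := (notMem_iff_exists_ne_and_isConjRoot hzM
    (IsAlgClosed.splits _)).1 (fun h => hzn (by
      obtain ⟨m, hm⟩ := Algebra.mem_bot.1 h
      rw [← hm]
      exact m.2))
  have hroot : aeval z' P = 0 := by
    obtain ⟨R, rfl⟩ := minpoly.dvd F z hz
    rw [map_mul, (hconj.of_isScalarTower hzsep.isIntegral).aeval_eq_zero, zero_mul]
  have hnorm : ‖z - y‖ = ‖z' - y‖ :=
    norm_eq_of_isConjRoot hF hb hb0 hb1 (hzsep.isIntegral.sub hy)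
      ((hconj.sub_algebraMap (⟨y, hyM⟩ : M)).of_isScalarTower (hzsep.isIntegral.sub hy))
  have h2 : ‖z' - z‖ < η := by
    rw [← sub_sub_sub_cancel_right z' z y]
    exact norm_sub_lt_of_lt (hnorm ▸ hyz) hyz
  exact h2.not_ge (hη z' hroot hne.symm)

end Krasner

section FarPoints

/-- `y` lies in an extension of `F` of degree at most `d`. -/
def LiesInDegreeLE (F : Subfield Ω) (d : ℕ) (y : Ω) : Prop :=
  ∃ M : IntermediateField F Ω, FiniteDimensional F M ∧ finrank F M ≤ d ∧ y ∈ M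

/-- Some algebraic point of the unit ball is at distance at least `δ` from every element of degree
at most `d` over `F`. -/
def HasFarPoint (F : Subfield Ω) (d : ℕ) (δ : ℝ) : Prop :=
  ∃ z : Ω, IsAlgebraic F z ∧ ‖z‖ ≤ 1 ∧ ∀ y, LiesInDegreeLE F d y → δ ≤ ‖z - y‖

variable {l : Subfield Ω}

lemma norm_natCast_eq_one_of_not_dvd {p : ℕ} (hp : p.Prime) (hp1 : ‖(p : Ω)‖ < 1) {u : ℕ}
    (hu : ¬ p ∣ u) : ‖(u : Ω)‖ = 1 := by
  refine le_antisymm (IsUltrametricDist.norm_natCast_le_one Ω u) ?_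
  by_contra! hlt
  obtain ⟨a, b, hab⟩ := Nat.isCoprime_iff_coprime.2 ((Nat.Prime.coprime_iff_not_dvd hp).2 hu)
  have h1 : (a : Ω) * p + b * u = 1 := by exact_mod_cast congrArg (Int.cast : ℤ → Ω) hab
  have h2 : ‖(a : Ω) * p + b * u‖ < 1 := by
    refine (IsUltrametricDist.norm_add_le_max _ _).trans_lt (max_lt ?_ ?_) <;> rw [norm_mul]
    · exact (mul_le_of_le_one_left (norm_nonneg _)
        (IsUltrametricDist.norm_intCast_le_one Ω a)).trans_lt hp1
    · exact (mul_le_of_le_one_left (norm_nonneg _)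
        (IsUltrametricDist.norm_intCast_le_one Ω b)).trans_lt hlt
  rw [h1, norm_one] at h2
  exact h2.false

lemma norm_pow_le_norm_natCast {p : ℕ} (hp : p.Prime) (hp1 : ‖(p : Ω)‖ < 1) {D n : ℕ}
    (hD0 : D ≠ 0) (hD : D < p ^ (n + 1)) : ‖(p : Ω)‖ ^ n ≤ ‖(D : Ω)‖ := by
  obtain ⟨j, u, hu, rfl⟩ := Nat.exists_eq_pow_mul_and_not_dvd hD0 p hp.ne_one
  have hu0 : 0 < u := Nat.pos_of_ne_zero (by rintro rfl; simp at hD0)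
  have hj : j < n + 1 :=
    (Nat.pow_lt_pow_iff_right hp.one_lt).1 ((Nat.le_mul_of_pos_right _ hu0).trans_lt hD)
  rw [Nat.cast_mul, norm_mul, norm_natCast_eq_one_of_not_dvd hp hp1 hu, mul_one, Nat.cast_pow,
    norm_pow]
  exact pow_le_pow_of_le_one (norm_nonneg _) hp1.le (Nat.lt_succ_iff.1 hj)

lemma norm_pow_sub_one_le {ζ : Ω} (hζ : ‖ζ‖ ≤ 1) (k : ℕ) : ‖ζ ^ k - 1‖ ≤ ‖ζ - 1‖ := by
  rw [← mul_geom_sum, norm_mul]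
  refine mul_le_of_le_one_right (norm_nonneg _) ?_
  refine IsUltrametricDist.norm_sum_le_of_forall_le_of_nonneg zero_le_one fun i _ => ?_
  rw [norm_pow]
  exact pow_le_one₀ (norm_nonneg _) hζ

lemma norm_natCast_le_norm_sub_one {p n : ℕ} (hp : p.Prime) {ζ : Ω} (h : ζ ^ p ^ n = 1)
    (h1 : ζ ≠ 1) : ‖(p : Ω)‖ ≤ ‖ζ - 1‖ := by
  induction n generalizing ζ with
  | zero => simp at h; exact absurd h h1
  | succ n ih =>
    have hζ : ‖ζ‖ ≤ 1 := by
      have : ‖ζ‖ ^ p ^ (n + 1) = 1 := by rw [← norm_pow, h, norm_one]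
      exact ((pow_eq_one_iff_of_nonneg (norm_nonneg _)
        (pow_ne_zero _ hp.ne_zero)).1 this).le
    by_cases hζp : ζ ^ p = 1
    · have hsum : ∑ i ∈ Finset.range p, ζ ^ i = 0 := by
        have := mul_geom_sum ζ p
        rw [hζp, sub_self] at this
        exact (mul_eq_zero.1 this).resolve_left (sub_ne_zero.2 h1)
      have : -(p : Ω) = ∑ i ∈ Finset.range p, (ζ ^ i - 1) := by simp [hsum]
      rw [← norm_neg, this]
      exact IsUltrametricDist.norm_sum_le_of_forall_le_of_nonneg (norm_nonneg _)
        fun i _ => norm_pow_sub_one_le hζ i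
    · exact (ih (by rw [← pow_mul, ← pow_succ', h]) hζp).trans (norm_pow_sub_one_le hζ p)

lemma le_hatGen (S : Set Ω) : l ≤ hatGen l S := fun _ hc => mem_hatGen_of_mem hc

lemma exists_forall_hasFarPoint_of_ne_zero [IsAlgClosed l] {b : Ω} (hb : b ∈ l) (hb0 : 0 < ‖b‖)
    (hb1 : ‖b‖ < 1) {p : ℕ} (hp : p.Prime) (hp0 : (p : Ω) ≠ 0) (hp1 : ‖(p : Ω)‖ < 1) {s : Ω}
    (hs : s ∉ closure (l : Set Ω)) : ∃ ε > 0, ∀ d, HasFarPoint (hatGen l {s}) d ε := by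
  have hne : (l : Set Ω).Nonempty := ⟨0, zero_mem l⟩
  have hr0 : 0 < infDist s (l : Set Ω) := (infDist_pos_iff_notMem_closure hne).1 hs
  set r := infDist s (l : Set Ω)
  have hr (c) (hc : c ∈ l) : r ≤ ‖s - c‖ := by
    rw [← dist_eq_norm]
    exact infDist_le_dist_of_mem hc
  have hpn : 0 < ‖(p : Ω)‖ := norm_pos_iff.2 hp0
  obtain ⟨c, hc, hcr⟩ := (infDist_lt_iff hne).1
    (show infDist s (l : Set Ω) < r / ‖(p : Ω)‖ from (lt_div_iff₀ hpn).2
      (mul_lt_of_lt_one_right hr0 hp1))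
  rw [dist_eq_norm, lt_div_iff₀ hpn] at hcr
  set F := hatGen l {s}
  have hFc : IsClosed (F : Set Ω) := Subfield.isClosed_topologicalClosure _
  set f : F := ⟨s - c, sub_mem (mem_hatGen_of_mem_set rfl) (mem_hatGen_of_mem hc)⟩
  have ht : 0 < ‖s - c‖ := hr0.trans_le (hr c hc)
  have hf0 : f ≠ 0 := fun h => (norm_pos_iff.1 ht) (congrArg Subtype.val h)
  obtain ⟨a, ha, hat, -⟩ := exists_mem_norm_between hb hb0 hb1
    (lt_max_of_lt_left one_pos : 0 < max 1 ‖s - c‖) (lt_add_one _)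
  have ha0 : 0 < ‖a‖ := (lt_max_of_lt_left one_pos).trans hat
  have haF : a ∈ F := mem_hatGen_of_mem ha
  refine ⟨min 1 ‖s - c‖ * ‖(p : Ω)‖ / ‖a‖, by positivity, fun d => ?_⟩
  obtain ⟨n, hn⟩ : ∃ n, d < p ^ (n + 1) :=
    ⟨d, (Nat.lt_pow_self hp.one_lt).trans (Nat.pow_lt_pow_right hp.one_lt d.lt_succ_self)⟩
  set q := p ^ (n + 1) with hq
  have hq0 : q ≠ 0 := pow_ne_zero _ hp.ne_zero
  obtain ⟨z, hz⟩ := IsAlgClosed.exists_pow_nat_eq (s - c) (Nat.pos_of_ne_zero hq0)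
  have hzn : ‖z‖ ^ q = ‖s - c‖ := by rw [← norm_pow, hz]
  have hz1 : ‖z‖ ≤ max 1 ‖s - c‖ := by
    rw [le_max_iff]
    refine (le_total ‖z‖ 1).imp_right fun h => ?_
    rw [← hzn]
    exact le_self_pow₀ h hq0
  have hz2 : min 1 ‖s - c‖ ≤ ‖z‖ := by
    rw [min_le_iff]
    refine (le_total 1 ‖z‖).imp_right fun h => ?_
    rw [← hzn]
    exact pow_le_of_le_one (norm_nonneg _) h hq0
  set P : F[X] := X ^ q - C f with hP
  have hPsep : P.Separable := separable_X_pow_sub_C f (by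
    intro h
    have : algebraMap F Ω (q : F) = 0 := by rw [h, map_zero]
    rw [map_natCast, hq, Nat.cast_pow] at this
    exact pow_ne_zero _ hp0 this) hf0
  have hPeval (x : Ω) : aeval x P = x ^ q - (s - c) := by
    simp [hP, show algebraMap F Ω f = s - c from rfl]
  have hzP : aeval z P = 0 := by rw [hPeval, hz, sub_self]
  have hzalg : IsAlgebraic F z := ⟨P, hPsep.ne_zero, hzP⟩
  refine ⟨z / a, ?_, ?_, ?_⟩
  · rw [div_eq_mul_inv]
    exact hzalg.mul (isAlgebraic_algebraMap (⟨a⁻¹, inv_mem haF⟩ : F))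
  · rw [norm_div, div_le_one ha0]
    exact hz1.trans hat.le
  · rintro y ⟨M, hM, hMd, hyM⟩
    by_contra! hlt
    have haM : a ∈ M := M.algebraMap_mem ⟨a, haF⟩
    have hzM : z ∈ M := by
      refine mem_intermediateField_of_norm_sub_lt (F := F) hFc
        (le_hatGen _ hb) hb0 hb1 M hPsep hzP (η := min 1 ‖s - c‖ * ‖(p : Ω)‖) ?_
        (y := a * y) ?_ (mul_mem haM hyM) ?_
      · intro z' hz' hne'
        have hz0 : z ≠ 0 := norm_pos_iff.1 ((lt_min one_pos ht).trans_le hz2)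
        have h1 : z' - z = z * (z' / z - 1) := by field_simp
        rw [hPeval, sub_eq_zero] at hz'
        rw [h1, norm_mul]
        refine mul_le_mul hz2 (norm_natCast_le_norm_sub_one hp (n := n + 1) ?_ ?_)
          (norm_nonneg _) (norm_nonneg _)
        · rw [div_pow, ← hq, hz', hz, div_self (norm_pos_iff.1 ht)]
        · rwa [Ne, div_eq_one_iff_eq hz0]
      · exact (Algebra.IsIntegral.isIntegral (⟨a * y, mul_mem haM hyM⟩ : M)).map M.val
      · have h1 : z - a * y = (z / a - y) * a := by
          field_simp [norm_pos_iff.1 ha0]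
        rwa [h1, norm_mul, ← lt_div_iff₀ ha0]
    set N : F := Algebra.norm F (⟨z, hzM⟩ : M) with hN
    have hNq : N ^ q = f ^ finrank F M := by
      rw [hN, ← map_pow, ← Algebra.norm_algebraMap]
      congr 1
      exact Subtype.ext hz
    have hNΩ : (N : Ω) ^ q = (s - c) ^ finrank F M := congrArg Subtype.val hNq
    have h1 := norm_mul_le_of_pow_eq_sub_pow hr0 hr N.2 hc hNΩ
    have h2 := norm_pow_le_norm_natCast hp hp1 (D := finrank F M) (n := n) finrank_pos.ne'
      (hMd.trans_lt hn)
    have h3 : ‖(p : Ω)‖ ^ n * r ≤ ‖(p : Ω)‖ ^ n * (‖s - c‖ * ‖(p : Ω)‖) := by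
      calc ‖(p : Ω)‖ ^ n * r ≤ ‖(finrank F M : Ω)‖ * r := by gcongr
        _ ≤ ‖(q : Ω)‖ * ‖s - c‖ := h1
        _ = ‖(p : Ω)‖ ^ n * (‖s - c‖ * ‖(p : Ω)‖) := by
          rw [hq, Nat.cast_pow, norm_pow]
          ring
    exact hcr.not_ge (le_of_mul_le_mul_left h3 (pow_pos hpn n))

lemma mem_of_forall_algHom_eq {F : Subfield Ω} (M : IntermediateField F Ω) {u : Ω} (hu : u ∈ M)
    (hsep : IsSeparable F u) [FiniteDimensional F M]
    (h : ∀ σ : M →ₐ[F] Ω, σ ⟨u, hu⟩ = u) : u ∈ F := by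
  by_contra hn
  obtain ⟨u', hne, hconj⟩ := (notMem_iff_exists_ne_and_isConjRoot hsep
    (IsAlgClosed.splits _)).1 (fun h => hn (by
      obtain ⟨m, hm⟩ := Algebra.mem_bot.1 h
      rw [← hm]
      exact m.2))
  obtain ⟨σ, hσ⟩ := IntermediateField.exists_algHom_of_splits_of_aeval (K := Ω) (F := F) (E := M)
    (fun t => ⟨Algebra.IsIntegral.isIntegral t, IsAlgClosed.splits _⟩)
    (x := (⟨u, hu⟩ : M)) (y := u') (by
      rw [← minpoly.algebraMap_eq (B' := Ω) (algebraMap M Ω).injective]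
      exact hconj.aeval_eq_zero)
  exact hne (by rw [← hσ, h])

/-- The trace-like sum `x + x ^ p + ⋯ + x ^ p ^ (n - 1)`. -/
def frobeniusSum (p n : ℕ) {R : Type*} [Semiring R] (x : R) : R := ∑ i ∈ Finset.range n, x ^ p ^ i

lemma frobeniusSum_pow_sub_self {R : Type*} [CommRing R] {p : ℕ} [ExpChar R p] (n : ℕ) (x : R) :
    frobeniusSum p n x ^ p - frobeniusSum p n x = x ^ p ^ n - x := by
  rw [frobeniusSum, sum_pow_char, ← Finset.sum_sub_distrib]
  simp_rw [← pow_mul, ← pow_succ]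
  rw [Finset.sum_range_sub (fun i => x ^ p ^ i), pow_zero, pow_one]

lemma frobeniusSum_sub {R : Type*} [CommRing R] {p : ℕ} [ExpChar R p] (n : ℕ) (x y : R) :
    frobeniusSum p n (x - y) = frobeniusSum p n x - frobeniusSum p n y := by
  simp_rw [frobeniusSum, sub_pow_expChar_pow, Finset.sum_sub_distrib]

lemma norm_pow_sub_self {x : Ω} {q : ℕ} (hq : 1 < q) (hx : 1 < ‖x‖) : ‖x ^ q - x‖ = ‖x‖ ^ q := by
  have h : ‖x‖ < ‖x ^ q‖ := by
    rw [norm_pow]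
    exact lt_self_pow₀ hx hq
  have hne : ‖x ^ q‖ ≠ ‖-x‖ := by
    rw [norm_neg]
    exact h.ne'
  rw [sub_eq_add_neg, IsUltrametricDist.norm_add_eq_max_of_norm_ne_norm hne, norm_neg, max_eq_left h.le, norm_pow]

lemma norm_eq_one_of_pow_eq_self {x : Ω} {q : ℕ} (hq : 1 < q) (hx : x ^ q = x) (h0 : x ≠ 0) :
    ‖x‖ = 1 := by
  have h1 : x ^ (q - 1) = 1 := by
    apply mul_right_cancel₀ h0
    rw [pow_sub_one_mul (by omega), hx, one_mul]
  have : ‖x‖ ^ (q - 1) = 1 := by rw [← norm_pow, h1, norm_one]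
  exact (pow_eq_one_iff_of_nonneg (norm_nonneg _) (by omega)).1 this

lemma separable_X_pow_sub_X_sub_C {F : Type*} [Field F] {q : ℕ} (hq : (q : F) = 0) (f : F) :
    (X ^ q - X - C f : F[X]).Separable := by
  refine ⟨0, -1, ?_⟩
  simp [derivative_X_pow, hq]

/-- If `z ^ p ^ n - z = f` with `z` of degree less than `n` over `F`, then some nonzero multiple
of `f` by an element of the field with `p ^ n` elements is an Artin-Schreier value on `F`. -/
lemma exists_artinSchreier_eq [IsAlgClosed l] {F : Subfield Ω} (hlF : l ≤ F) {p : ℕ}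
    (hp : p.Prime) (hp0 : (p : Ω) = 0) {n : ℕ} {f z : Ω} (hf : f ∈ F) (hz : z ^ p ^ n - z = f)
    (M : IntermediateField F Ω) [FiniteDimensional F M] (hMn : finrank F M < n) (hzM : z ∈ M) :
    ∃ b ∈ l, ‖b‖ = 1 ∧ ∃ g ∈ F, g ^ p - g = b * f := by
  classical
  have := Fact.mk hp
  have : CharP Ω p := (CharP.charP_iff_prime_eq_zero hp).2 hp0
  have hn0 : n ≠ 0 := by omega
  have hqc : 1 < p ^ n := Nat.one_lt_pow hn0 hp.one_lt
  have hpl : (p : l) = 0 := Subtype.ext (by simp)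
  have : CharP l p := (CharP.charP_iff_prime_eq_zero hp).2 hpl
  have hpF : (p : F) = 0 := Subtype.ext (by simp)
  set T : Finset l := (X ^ p ^ n - X : l[X]).roots.toFinset
  have hT0 : (X ^ p ^ n - X : l[X]) ≠ 0 := FiniteField.X_pow_card_pow_sub_X_ne_zero l hn0 hp.one_lt
  have hTmem (b : l) (hb : b ∈ T) : (b : Ω) ^ p ^ n = b := by
    have := (mem_roots hT0).1 (Multiset.mem_toFinset.1 hb)
    rw [IsRoot.def, eval_sub, eval_pow, eval_X, sub_eq_zero] at this
    exact congrArg Subtype.val this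
  have hTcard : T.card = p ^ n := by
    have hsep : (X ^ p ^ n - X : l[X]).Separable := by
      simpa using separable_X_pow_sub_X_sub_C (F := l) (q := p ^ n) (by simp [hn0]) 0
    rw [Multiset.toFinset_card_of_nodup (nodup_roots hsep),
      ← (IsAlgClosed.splits (X ^ p ^ n - X : l[X])).natDegree_eq_card_roots,
      FiniteField.X_pow_card_pow_sub_X_natDegree_eq l hn0 hp.one_lt]
  set R : Finset Ω := (X ^ p - X : Polynomial Ω).roots.toFinset
  have hRmem (t : Ω) (ht : t ^ p = t) : t ∈ R := by
    rw [Multiset.mem_toFinset, mem_roots (FiniteField.X_pow_card_sub_X_ne_zero Ω hp.one_lt)]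
    simp [ht]
  have hRcard : R.card ≤ p := by
    refine (Multiset.toFinset_card_le _).trans ((card_roots' _).trans ?_)
    rw [FiniteField.X_pow_card_sub_X_natDegree_eq Ω hp.one_lt]
  have hbM (b : l) : (b : Ω) ∈ M := M.algebraMap_mem ⟨b, hlF b.2⟩
  have hwM (b : l) : frobeniusSum p n (b * z : Ω) ∈ M :=
    sum_mem fun i _ => pow_mem (mul_mem (hbM b) hzM) _
  have hw (b : l) (hb : (b : Ω) ^ p ^ n = b) :
      frobeniusSum p n (b * z : Ω) ^ p - frobeniusSum p n (b * z : Ω) = b * f := by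
    rw [frobeniusSum_pow_sub_self, mul_pow, hb, ← hz]
    ring
  have hwσ (b : l) (hb : (b : Ω) ^ p ^ n = b) (σ : M →ₐ[F] Ω) :
      σ ⟨_, hwM b⟩ - frobeniusSum p n (b * z : Ω) ∈ R := by
    apply hRmem
    have h1 : σ ⟨_, hwM b⟩ ^ p - σ ⟨_, hwM b⟩ = b * f := by
      rw [← map_pow, ← map_sub]
      have : (⟨_, hwM b⟩ ^ p - ⟨_, hwM b⟩ : M)
          = algebraMap F M ⟨b * f, mul_mem (hlF b.2) hf⟩ := Subtype.ext (hw b hb)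
      rw [this, AlgHom.commutes]
      rfl
    rw [sub_pow_char]
    linear_combination h1 - hw b hb
  have : Fintype (M →ₐ[F] Ω) := Fintype.ofFinite _
  have hσ : Fintype.card (M →ₐ[F] Ω) ≤ finrank F M := by
    rw [← Nat.card_eq_fintype_card]
    exact card_algHom_le_finrank F M Ω
  obtain ⟨b, hb, b', hb', hbb, heq⟩ := Finset.exists_ne_map_eq_of_card_lt_of_maps_to
    (s := T) (t := Fintype.piFinset fun _ : M →ₐ[F] Ω => R)
    (f := fun b σ => σ ⟨_, hwM b⟩ - frobeniusSum p n (b * z : Ω))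
    (by
      rw [Fintype.card_piFinset, Finset.prod_const, Finset.card_univ, hTcard]
      calc R.card ^ _ ≤ p ^ _ := Nat.pow_le_pow_left hRcard _
        _ < p ^ n := Nat.pow_lt_pow_right hp.one_lt (hσ.trans_lt hMn))
    (fun b hb => Fintype.mem_piFinset.2 fun σ => hwσ b (hTmem b hb) σ)
  have hd : ((b - b' : l) : Ω) ^ p ^ n = (b - b' : l) := by
    push_cast
    rw [sub_pow_char_pow, hTmem b hb, hTmem b' hb']
  have hsub : frobeniusSum p n ((b - b' : l) * z : Ω)
      = frobeniusSum p n (b * z : Ω) - frobeniusSum p n (b' * z : Ω) := by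
    rw [← frobeniusSum_sub, ← sub_mul]
    rfl
  have hAS := hw (b - b') hd
  refine ⟨(b - b' : l), (b - b').2, norm_eq_one_of_pow_eq_self hqc hd
    (fun h => hbb (sub_eq_zero.1 (Subtype.ext h))), _, ?_, hAS⟩
  refine mem_of_forall_algHom_eq M (hwM (b - b')) ?_ fun σ => ?_
  · refine (separable_X_pow_sub_X_sub_C hpF
      (⟨(b - b' : l) * f, mul_mem (hlF (b - b').2) hf⟩ : F)).of_dvd (minpoly.dvd F _ ?_)
    rw [map_sub, map_sub, map_pow, aeval_X, aeval_C, hAS]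
    exact sub_self _
  · have h1 : (⟨_, hwM (b - b')⟩ : M) = ⟨_, hwM b⟩ - ⟨_, hwM b'⟩ := Subtype.ext hsub
    have h2 := congrFun heq σ
    rw [h1, map_sub, hsub]
    linear_combination h2

lemma exists_forall_hasFarPoint_of_eq_zero [IsAlgClosed l] {b : Ω} (hb : b ∈ l) (hb0 : 0 < ‖b‖)
    (hb1 : ‖b‖ < 1) {p : ℕ} (hp : p.Prime) (hp0 : (p : Ω) = 0) {s : Ω}
    (hs : s ∉ closure (l : Set Ω)) : ∃ ε > 0, ∀ d, HasFarPoint (hatGen l {s}) d ε := by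
  have hne : (l : Set Ω).Nonempty := ⟨0, zero_mem l⟩
  have hr0 : 0 < infDist s (l : Set Ω) := (infDist_pos_iff_notMem_closure hne).1 hs
  set r := infDist s (l : Set Ω)
  have hr (c) (hc : c ∈ l) : r ≤ ‖s - c‖ := by
    rw [← dist_eq_norm]
    exact infDist_le_dist_of_mem hc
  have hsn : 0 < ‖s‖ := by simpa using hr0.trans_le (hr 0 (zero_mem l))
  set F := hatGen l {s}
  have hFc : IsClosed (F : Set Ω) := Subfield.isClosed_topologicalClosure _
  have hsF : s ∈ F := mem_hatGen_of_mem_set rfl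
  obtain ⟨a, ha, hal, -⟩ := exists_mem_norm_between hb hb0 hb1
    (lt_max_of_lt_left (one_div_pos.2 hr0) : 0 < max (1 / r) (‖s‖ / r ^ 2)) (lt_add_one _)
  rw [max_lt_iff, div_lt_iff₀ hr0, div_lt_iff₀ (by positivity)] at hal
  obtain ⟨har1, har2⟩ := hal
  have hno (b) (hbl : b ∈ l) (hbn : ‖b‖ = 1) (g) (hg : g ∈ F) : g ^ p - g ≠ b * (a * s) := by
    intro h
    rw [← mul_assoc] at h
    have h1 := norm_mul_le_of_artinSchreier hr0 hr hp.ne_zero hp0 hg (mul_mem hbl ha) h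
    rw [norm_mul, hbn, one_mul] at h1
    have hg1 : 1 < ‖g‖ := har1.trans_le h1
    have h2 : ‖g‖ ^ p = ‖a‖ * ‖s‖ := by
      rw [← norm_pow_sub_self hp.one_lt hg1, h, norm_mul, norm_mul, hbn, one_mul]
    have h4 : (‖a‖ * r) ^ 2 ≤ ‖a‖ * ‖s‖ := by
      rw [← h2]
      exact (pow_le_pow_left₀ (by positivity) h1 2).trans (pow_le_pow_right₀ hg1.le hp.two_le)
    have ha0 : 0 < ‖a‖ := by
      by_contra! h
      nlinarith
    rw [mul_pow, sq, mul_assoc] at h4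
    exact har2.not_ge (le_of_mul_le_mul_left h4 ha0)
  obtain ⟨e, he, hel, -⟩ := exists_mem_norm_between hb hb0 hb1
    (lt_max_of_lt_left one_pos : 0 < max 1 ‖a * s‖) (lt_add_one _)
  have he0 : 0 < ‖e‖ := (lt_max_of_lt_left one_pos).trans hel
  have heF : e ∈ F := mem_hatGen_of_mem he
  have haF : a ∈ F := mem_hatGen_of_mem ha
  refine ⟨1 / ‖e‖, by positivity, fun d => ?_⟩
  set f : F := ⟨a * s, mul_mem haF hsF⟩
  set q := p ^ (d + 1) with hq
  have hq1 : 1 < q := Nat.one_lt_pow d.succ_ne_zero hp.one_lt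
  have hqF : (q : F) = 0 := by
    have : (p : F) = 0 := Subtype.ext (by simp [hp0])
    simp [hq, this]
  set P : F[X] := X ^ q - X - C f with hP
  have hPsep : P.Separable := separable_X_pow_sub_X_sub_C hqF f
  have hPeval (x : Ω) : aeval x P = x ^ q - x - a * s := by
    simp [hP, show algebraMap F Ω f = a * s from rfl]
  obtain ⟨z, hzP⟩ := IsAlgClosed.exists_aeval_eq_zero Ω P (by
    have h1 : (X + C f : F[X]).degree < (X ^ q : F[X]).degree := by
      rw [degree_X_add_C, degree_X_pow]
      exact_mod_cast hq1
    rw [hP, sub_sub, degree_sub_eq_left_of_degree_lt h1, degree_X_pow]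
    exact_mod_cast (zero_lt_one.trans hq1).ne')
  have hz : z ^ q - z = a * s := by rwa [hPeval, sub_eq_zero] at hzP
  have hz1 : ‖z‖ ≤ max 1 ‖a * s‖ := by
    rw [le_max_iff]
    by_contra! h
    have h3 : ‖z‖ < ‖a * s‖ := by
      rw [← hz, norm_pow_sub_self hq1 h.1]
      exact lt_self_pow₀ h.1 hq1
    exact h.2.not_gt h3
  have hzalg : IsAlgebraic F z := ⟨P, hPsep.ne_zero, hzP⟩
  refine ⟨z / e, ?_, ?_, ?_⟩
  · rw [div_eq_mul_inv]
    exact hzalg.mul (isAlgebraic_algebraMap (⟨e⁻¹, inv_mem heF⟩ : F))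
  · rw [norm_div, div_le_one he0]
    exact hz1.trans hel.le
  · rintro y ⟨M, hM, hMd, hyM⟩
    by_contra! hlt
    have heM : e ∈ M := M.algebraMap_mem ⟨e, heF⟩
    have hzM : z ∈ M := by
      refine mem_intermediateField_of_norm_sub_lt (F := F) hFc
        (le_hatGen _ hb) hb0 hb1 M hPsep hzP (η := 1) ?_
        (y := e * y) ?_ (mul_mem heM hyM) ?_
      · intro z' hz' hne'
        have := Fact.mk hp
        have : CharP Ω p := (CharP.charP_iff_prime_eq_zero hp).2 hp0
        rw [hPeval, sub_eq_zero] at hz'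
        refine (norm_eq_one_of_pow_eq_self hq1 ?_ (sub_ne_zero.2 hne')).ge
        rw [hq, sub_pow_char_pow, ← hq]
        linear_combination hz' - hz
      · exact (Algebra.IsIntegral.isIntegral (⟨e * y, mul_mem heM hyM⟩ : M)).map M.val
      · have h1 : z - e * y = (z / e - y) * e := by
          field_simp [norm_pos_iff.1 he0]
        rwa [h1, norm_mul, ← lt_div_iff₀ he0]
    obtain ⟨b', hb', hbn', g, hg, hgb⟩ := exists_artinSchreier_eq (l := l) (F := F) (le_hatGen _)
      hp hp0 f.2 hz M (Nat.lt_succ_of_le hMd) hzM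
    exact hno b' hb' hbn' g hg hgb

lemma LiesInDegreeLE.isAlgebraic {F : Subfield Ω} {d : ℕ} {y : Ω} (h : LiesInDegreeLE F d y) :
    IsAlgebraic F y := by
  obtain ⟨M, hM, -, hy⟩ := h
  exact (Algebra.IsAlgebraic.isAlgebraic (⟨y, hy⟩ : M)).algebraMap (A := Ω)

lemma LiesInDegreeLE.mul_add_mul {F : Subfield Ω} {d₁ d₂ : ℕ} {y₁ y₂ : Ω}
    (h₁ : LiesInDegreeLE F d₁ y₁) (h₂ : LiesInDegreeLE F d₂ y₂) {a₁ a₂ : Ω} (ha₁ : a₁ ∈ F)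
    (ha₂ : a₂ ∈ F) : LiesInDegreeLE F (d₁ * d₂) (a₁ * y₁ + a₂ * y₂) := by
  obtain ⟨M₁, hM₁, hd₁, hy₁⟩ := h₁
  obtain ⟨M₂, hM₂, hd₂, hy₂⟩ := h₂
  refine ⟨M₁ ⊔ M₂, inferInstance, (finrank_sup_le M₁ M₂).trans (Nat.mul_le_mul hd₁ hd₂), ?_⟩
  exact add_mem (mul_mem ((M₁ ⊔ M₂).algebraMap_mem ⟨a₁, ha₁⟩) ((le_sup_left : M₁ ≤ M₁ ⊔ M₂) hy₁))
    (mul_mem ((M₁ ⊔ M₂).algebraMap_mem ⟨a₂, ha₂⟩) ((le_sup_right : M₂ ≤ M₁ ⊔ M₂) hy₂))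

lemma exists_liesInDegreeLE {F : Subfield Ω} {y : Ω} (h : IsAlgebraic F y) :
    ∃ d, LiesInDegreeLE F d y :=
  ⟨_, F⟮y⟯, adjoin.finiteDimensional h.isIntegral, le_rfl, mem_adjoin_simple_self F y⟩

lemma exists_liesInDegreeLE_norm_sub_le {F : Subfield Ω} {d : ℕ} {a : Ω} (ha : a ∈ F) (ha0 : a ≠ 0)
    (h : ∀ z, IsAlgebraic F z → ‖z‖ ≤ 1 → ∃ y, LiesInDegreeLE F d y ∧ ‖z - y‖ ≤ ‖a‖) (n : ℕ) {z : Ω}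
    (hz : IsAlgebraic F z) (hz1 : ‖z‖ ≤ 1) :
    ∃ y, LiesInDegreeLE F (d ^ n) y ∧ ‖z - y‖ ≤ ‖a‖ ^ n := by
  induction n generalizing z with
  | zero =>
    refine ⟨0, ⟨⊥, inferInstance, ?_, zero_mem _⟩, by simpa using hz1⟩
    rw [IntermediateField.finrank_bot, pow_zero]
  | succ n ih =>
    obtain ⟨y, hy, hzy⟩ := h z hz hz1
    have ha0' : 0 < ‖a‖ := norm_pos_iff.2 ha0
    obtain ⟨y', hy', hzy'⟩ := ih (z := (z - y) / a)
      (by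
        rw [div_eq_mul_inv]
        exact (hz.sub hy.isAlgebraic).mul (isAlgebraic_algebraMap (⟨a⁻¹, inv_mem ha⟩ : F)))
      (by rwa [norm_div, div_le_one ha0'])
    refine ⟨1 * y + a * y', ?_, ?_⟩
    · rw [pow_succ']
      exact hy.mul_add_mul hy' (one_mem F) ha
    · have : z - (1 * y + a * y') = ((z - y) / a - y') * a := by
        field_simp
        ring
      rw [this, norm_mul, pow_succ]
      gcongr

lemma hasFarPoint_of_lt_one [IsAlgClosed l] {b : Ω} (hb : b ∈ l) (hb0 : 0 < ‖b‖) (hb1 : ‖b‖ < 1)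
    {F : Subfield Ω} (hlF : l ≤ F) {ε : ℝ} (hε : 0 < ε) (h : ∀ d, HasFarPoint F d ε) (d : ℕ) {δ : ℝ}
    (hδ : δ < 1) : HasFarPoint F d δ := by
  by_contra hn
  obtain ⟨a, ha, hδa, ha1⟩ := exists_mem_norm_between hb hb0 hb1
    (lt_max_of_lt_right one_half_pos : 0 < max δ (1 / 2)) (max_lt hδ one_half_lt_one)
  have ha0 : 0 < ‖a‖ := (lt_max_of_lt_right one_half_pos).trans hδa
  simp only [HasFarPoint, not_exists, not_and, not_forall, not_le] at hn
  obtain ⟨n, hnε⟩ := exists_pow_lt_of_lt_one hε ha1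
  obtain ⟨z, hz, hz1, hzfar⟩ := h (d ^ n)
  obtain ⟨y, hy, hzy⟩ := exists_liesInDegreeLE_norm_sub_le (d := d) (hlF ha) (norm_pos_iff.1 ha0)
    (fun z hz hz1 => by
      obtain ⟨y, hy, hzy⟩ := hn z hz hz1
      exact ⟨y, hy, (hzy.trans ((le_max_left _ _).trans_lt hδa)).le⟩) n hz hz1
  exact (hzfar y hy).not_gt (hzy.trans_lt hnε)

lemma exists_isAlgebraic_far [IsAlgClosed l] {b : Ω} (hb : b ∈ l) (hb0 : 0 < ‖b‖) (hb1 : ‖b‖ < 1)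
    {F : Subfield Ω} (hlF : l ≤ F) (h : ∀ d δ, δ < 1 → HasFarPoint F d δ) (d : ℕ) {c : Ω}
    (hc : IsAlgebraic F c) {ρ ρ' : ℝ} (hρ0 : 0 < ρ') (hρ : ρ' < ρ) :
    ∃ c', IsAlgebraic F c' ∧ ‖c' - c‖ ≤ ρ ∧ ∀ y, LiesInDegreeLE F d y → ρ' < ‖c' - y‖ := by
  obtain ⟨a, ha, ha1, ha2⟩ := exists_mem_norm_between hb hb0 hb1 hρ0 hρ
  have ha0 : 0 < ‖a‖ := hρ0.trans ha1
  have ha0' : a ≠ 0 := norm_pos_iff.1 ha0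
  obtain ⟨δ, hδ, hδ1⟩ := exists_between ((div_lt_one ha0).2 ha1)
  obtain ⟨m, hm⟩ := exists_liesInDegreeLE hc
  obtain ⟨z, hz, hz1, hzfar⟩ := h (m * d) δ hδ1
  refine ⟨c + a * z, hc.add ((isAlgebraic_algebraMap (⟨a, hlF ha⟩ : F)).mul hz), ?_, fun y hy => ?_⟩
  · rw [add_sub_cancel_left, norm_mul]
    exact (mul_le_of_le_one_right ha0.le hz1).trans ha2.le
  · have h1 := hzfar _ (hm.mul_add_mul hy (neg_mem (inv_mem (hlF ha))) (inv_mem (hlF ha)))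
    have h2 : c + a * z - y = (z - (-a⁻¹ * c + a⁻¹ * y)) * a := by
      field_simp
      ring
    rw [h2, norm_mul, ← div_lt_iff₀ ha0]
    exact hδ.trans_le h1

end FarPoints

section SphericalCompleteness

lemma not_sphericallyCompleteSpace_of_chain {F K : Subfield Ω}
    (hFK : ∀ x : Ω, IsAlgebraic F x → x ∈ K)
    (hK : (K : Set Ω) ⊆ closure {x | IsAlgebraic F x})
    (h : ∀ (d : ℕ) (c : Ω), IsAlgebraic F c → ∀ ρ ρ' : ℝ, 0 < ρ' → ρ' < ρ →
      ∃ c', IsAlgebraic F c' ∧ ‖c' - c‖ ≤ ρ ∧ ∀ y, LiesInDegreeLE F d y → ρ' < ‖c' - y‖) :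
    ¬ SphericallyCompleteSpace K := by
  intro hsph
  set ρ : ℕ → ℝ := fun n => 1 + (1 / 2) ^ n with hρdef
  have hρ1 (n) : 1 < ρ n := by simp [hρdef]
  have hρ (n) : ρ (n + 1) < ρ n := by
    simp only [hρdef, pow_succ]
    have : (0 : ℝ) < (1 / 2) ^ n := by positivity
    linarith
  choose g hgalg hgnear hgfar using fun (n : ℕ) (c : {c : Ω // IsAlgebraic F c}) =>
    h n c c.2 (ρ n) (ρ (n + 1)) (zero_lt_one.trans (hρ1 _)) (hρ n)
  let c : ℕ → {c : Ω // IsAlgebraic F c} :=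
    fun n => Nat.rec ⟨0, isAlgebraic_zero⟩ (fun n c => ⟨g n c, hgalg n c⟩) n
  let cK : ℕ → K := fun n => ⟨(c n).1, hFK (c n).1 (c n).2⟩
  have hanti : Antitone fun n => closedBall (cK n) (ρ n) := by
    refine antitone_nat_of_succ_le fun n x hx => ?_
    rw [mem_closedBall] at hx ⊢
    refine (dist_triangle_max x (cK (n + 1)) (cK n)).trans (max_le (hx.trans (hρ n).le) ?_)
    exact (dist_eq_norm (cK (n + 1) : Ω) (cK n)).trans_le (hgnear n (c n))
  obtain ⟨x, hx⟩ := hsph (Set.range fun n => (cK n, ρ n)) (Set.range_nonempty _)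
    (by
      rintro _ ⟨n, rfl⟩
      exact (zero_lt_one.trans (hρ1 n)).le)
    (by
      rintro _ ⟨m, rfl⟩ _ ⟨n, rfl⟩
      exact (le_total n m).imp (fun h => hanti h) fun h => hanti h)
  rw [Set.mem_iInter₂] at hx
  obtain ⟨y, hy, hxy⟩ := Metric.mem_closure_iff.1 (hK x.2) 1 one_pos
  obtain ⟨m, hm⟩ := exists_liesInDegreeLE hy
  have h1 : dist (cK (m + 1) : Ω) x ≤ ρ (m + 1) := by
    rw [dist_comm]
    exact hx _ ⟨m + 1, rfl⟩
  have h2 : ρ (m + 1) < dist (cK (m + 1) : Ω) y := by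
    rw [dist_eq_norm]
    exact hgfar m (c m) y hm
  exact h2.not_ge ((dist_triangle_max _ (x : Ω) _).trans
    (max_le h1 (hxy.le.trans (hρ1 _).le)))

lemma sphericallyCompleteSpace_of_dist_eq_one {X : Type*} [MetricSpace X]
    (h : ∀ x y : X, x ≠ y → dist x y = 1) : SphericallyCompleteSpace X := by
  rintro B ⟨p₀, hp₀⟩ hB hchain
  by_cases hsmall : ∃ p ∈ B, p.2 < 1
  · obtain ⟨p, hp, hp1⟩ := hsmall
    refine ⟨p.1, Set.mem_iInter₂.2 fun q hq => ?_⟩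
    rcases hchain p hp q hq with hpq | hpq
    · exact hpq (mem_closedBall_self (hB p hp))
    · have hqp := mem_closedBall.1 (hpq (mem_closedBall_self (hB q hq)))
      have : q.1 = p.1 := by
        by_contra hne
        exact (hqp.trans_lt hp1).ne (h _ _ hne)
      rw [← this]
      exact mem_closedBall_self (hB q hq)
  · push Not at hsmall
    refine ⟨p₀.1, Set.mem_iInter₂.2 fun q hq => ?_⟩
    rw [mem_closedBall]
    by_cases hne : p₀.1 = q.1
    · rw [hne, dist_self]
      exact hB q hq
    · exact (h _ _ hne).trans_le (hsmall q hq)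

lemma SphericallyCompleteSpace.of_eq {K : Subfield Ω} (hK : SphericallyCompleteSpace K) {A : Set Ω}
    (h : A = K) : SphericallyCompleteSpace A := by
  subst h
  exact hK

end SphericalCompleteness

section Subfields

lemma isAlgebraic_of_subfield_le {k k' : Subfield Ω} (h : k ≤ k') {x : Ω} (hx : IsAlgebraic k x) :
    IsAlgebraic k' x := by
  let _ : Algebra k k' := (Subfield.inclusion h).toAlgebra
  have : IsScalarTower k k' Ω := IsScalarTower.of_algebraMap_eq fun _ => rfl
  exact hx.tower_top k'

lemma mem_of_isAlgebraic {K : Subfield Ω} [IsAlgClosed K] {x : Ω} (hx : IsAlgebraic K x) :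
    x ∈ K := by
  obtain ⟨y, hy⟩ := minpoly.mem_range_of_degree_eq_one K x
    (IsAlgClosed.degree_eq_one_of_irreducible K (minpoly.irreducible hx.isIntegral))
  rw [← hy]
  exact y.2

lemma hatGen_le {k K : Subfield Ω} {S : Set Ω} (hK : IsClosed (K : Set Ω)) (hk : k ≤ K)
    (hS : S ⊆ K) : hatGen k S ≤ K :=
  Subfield.topologicalClosure_minimal _ (Subfield.closure_le.2 (Set.union_subset hk hS)) hK

lemma isClosed_hatGen (k : Subfield Ω) (S : Set Ω) : IsClosed (hatGen k S : Set Ω) :=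
  Subfield.isClosed_topologicalClosure _

lemma exists_isAlgebraic_norm_lt_one {k : Subfield Ω}
    (h : ¬ SphericallyCompleteSpace ↥(closure {x : Ω | IsAlgebraic k x})) :
    ∃ b : Ω, IsAlgebraic k b ∧ 0 < ‖b‖ ∧ ‖b‖ < 1 := by
  by_contra! hn
  refine h (sphericallyCompleteSpace_of_dist_eq_one fun x y hxy => ?_)
  have hA : {x : Ω | IsAlgebraic k x} = ((algebraicClosure k Ω).toSubfield : Set Ω) :=
    Set.ext fun x => mem_algebraicClosure_iff.symm
  have hmem : (x : Ω) - y ∈ closure {x : Ω | IsAlgebraic k x} := by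
    have key (a c : Ω) (ha : a ∈ closure {x : Ω | IsAlgebraic k x})
        (hc : c ∈ closure {x : Ω | IsAlgebraic k x}) :
        a - c ∈ closure {x : Ω | IsAlgebraic k x} := by
      rw [hA] at ha hc ⊢
      exact sub_mem (H := (algebraicClosure k Ω).toSubfield.topologicalClosure) ha hc
    exact key x y x.2 y.2
  have hsub : {x : Ω | IsAlgebraic k x} ⊆ {x : Ω | ‖x‖ = 0 ∨ ‖x‖ = 1} := fun a ha => by
    by_cases ha0 : a = 0
    · exact Or.inl (norm_eq_zero.2 ha0)
    · refine Or.inr (le_antisymm ?_ (hn a ha (norm_pos_iff.2 ha0)))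
      have := hn a⁻¹ ha.inv (norm_pos_iff.2 (inv_ne_zero ha0))
      rw [norm_inv] at this
      exact (one_le_inv₀ (norm_pos_iff.2 ha0)).1 this
  have hclosed : IsClosed {x : Ω | ‖x‖ = 0 ∨ ‖x‖ = 1} :=
    (isClosed_eq continuous_norm continuous_const).union
      (isClosed_eq continuous_norm continuous_const)
  refine (dist_eq_norm (x : Ω) y).trans ((closure_minimal hsub hclosed hmem).resolve_left ?_)
  rw [norm_eq_zero, sub_eq_zero]
  exact fun h => hxy (Subtype.ext h)

end Subfields

/-- Theorem 5.3.1: if `hat{k^a}` is not spherically complete, `K` is an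
algebraically closed and spherically complete analytic extension of `k`, and `k` has
positive residue characteristic, then `K/k` admits no topological transcendence basis. -/
theorem spherically_complete_no_basis (k K : Subfield Ω)
    (hkc : IsClosed (k : Set Ω)) (hKc : IsClosed (K : Set Ω)) (hkK : k ≤ K)
    (hnotsph : ¬ SphericallyCompleteSpace ↥(closure {x : Ω | IsAlgebraic k x}))
    (hKalgcl : IsAlgClosed K)
    (hKsph : SphericallyCompleteSpace K)
    (hp : ∃ p : ℕ, p.Prime ∧ ‖(p : Ω)‖ < 1) :
    ¬ ∃ S : Set Ω, S ⊆ (K : Set Ω) ∧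
      TopgebraicIndep k S ∧ TopgebraicallyGenerates k K S := by
  rintro ⟨S, hSK, hind, hgen⟩
  rcases S.eq_empty_or_nonempty with rfl | ⟨s, hs⟩
  · refine hnotsph (hKsph.of_eq (Set.Subset.antisymm ?_ (hgen.trans (closure_mono fun x hx => ?_))))
    · exact closure_minimal
        (fun x hx => mem_of_isAlgebraic (isAlgebraic_of_subfield_le hkK hx)) hKc
    · exact isAlgebraic_of_subfield_le (hatGen_le hkc le_rfl (Set.empty_subset _)) hx
  obtain ⟨b, hbalg, hb0, hb1⟩ := exists_isAlgebraic_norm_lt_one hnotsph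
  obtain ⟨p, hp, hp1⟩ := hp
  set k' := hatGen k (S \ {s})
  set l : Subfield Ω := (algebraicClosure k' Ω).toSubfield
  have hl (x : Ω) : x ∈ l ↔ IsAlgebraic k' x := mem_algebraicClosure_iff
  have hkl : k' ≤ l := fun x hx => (hl x).2 (isAlgebraic_algebraMap (⟨x, hx⟩ : k'))
  have hlcl : IsAlgClosed l := (algebraicClosure.isAlgClosure k' Ω).isAlgClosed
  have hk'K : k' ≤ K := hatGen_le hKc hkK (Set.sdiff_subset.trans hSK)
  have hlK : l ≤ K := fun x hx =>
    mem_of_isAlgebraic (isAlgebraic_of_subfield_le hk'K ((hl x).1 hx))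
  have hsl : s ∉ closure (l : Set Ω) := by
    rw [show (l : Set Ω) = {x : Ω | IsAlgebraic k' x} from Set.ext hl]
    exact hind s hs
  have hbl : b ∈ l := (hl b).2 (isAlgebraic_of_subfield_le (fun x hx => mem_hatGen_of_mem hx) hbalg)
  have hlF : l ≤ hatGen l {s} := le_hatGen _
  have hSF : hatGen k S ≤ hatGen l {s} := by
    refine hatGen_le (isClosed_hatGen _ _)
      (fun x hx => hlF (hkl (mem_hatGen_of_mem hx))) fun x hx => ?_
    by_cases hxs : x = s
    · exact mem_hatGen_of_mem_set hxs
    · exact hlF (hkl (mem_hatGen_of_mem_set ⟨hx, hxs⟩))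
  have hFK : hatGen l {s} ≤ K := hatGen_le hKc hlK (Set.singleton_subset_iff.2 (hSK hs))
  obtain ⟨ε, hε, hfar⟩ : ∃ ε > 0, ∀ d, HasFarPoint (hatGen l {s}) d ε := by
    by_cases hp0 : (p : Ω) = 0
    · exact exists_forall_hasFarPoint_of_eq_zero hbl hb0 hb1 hp hp0 hsl
    · exact exists_forall_hasFarPoint_of_ne_zero hbl hb0 hb1 hp hp0 hp1 hsl
  refine not_sphericallyCompleteSpace_of_chain
    (fun x hx => mem_of_isAlgebraic (isAlgebraic_of_subfield_le hFK hx))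
    (hgen.trans (closure_mono fun x hx => isAlgebraic_of_subfield_le hSF hx))
    (fun d c hc ρ ρ' hρ0 hρ => exists_isAlgebraic_far hbl hb0 hb1 hlF
      (fun d δ hδ => hasFarPoint_of_lt_one hbl hb0 hb1 hlF hε hfar d hδ) d hc hρ0 hρ) hKsph
end
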